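/- Let β, a, b ∈ ℂ and let θ ∈ (0, 2π), w := e^{iθ} (so the ray {t w : t ≥ 0} avoids the singular point p = 1). Consider the convolution equation, for measurable F : (0, ∞) → ℂ: (1 − t w) F(t) = t w − β w ∫₀^t F(s) ds + a w ∫₀^t F(s) F(t−s) ds + b w² ∫₀^t (∫₀^s F(u) F(s−u) du) F(t−s) ds for a.e. t > 0. Then there exists ν₀ > 0 such that for every ν ≥ ν₀ this equation has a solution F with ∫₀^∞ |F(t)| e^{−νt} dt < ∞, and any two solutions F₁, F₂ each having finite ‖·‖_ν norm for some (possibly different) ν agree almost everywhere; i.e., the equation has a unique solution in ⋃_{ν ≥ ν₀} L¹_ν. -/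

import Mathlib

open MeasureTheory Set Real

/-- The Borel transform, along the ray `arg p = θ` (`p = t e^{iθ}`, `w = e^{iθ}`), of
the model equation `f' + (1-β/x) f = x⁻² + a f² + b f³`:
`(1 - p) F = p - β F*1 + a F*F + b F*F*F`. -/
def BorelRayEq (β a b w : ℂ) (F : ℝ → ℂ) : Prop :=
  ∀ᵐ (t : ℝ) ∂(volume.restrict (Ioi (0:ℝ))),
    (1 - (t : ℂ) * w) * F t =
      (t : ℂ) * w - β * w * (∫ s in (0:ℝ)..t, F s)
        + a * w * (∫ s in (0:ℝ)..t, F s * F (t - s))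
        + b * w ^ 2 *
          (∫ s in (0:ℝ)..t, (∫ u in (0:ℝ)..s, F u * F (s - u)) * F (t - s))

/-- Membership in the weighted space `L¹_ν` along the ray. -/
def MemLoneNu (ν : ℝ) (F : ℝ → ℂ) : Prop :=
  Measurable F ∧ IntegrableOn (fun t => ‖F t‖ * Real.exp (-ν * t)) (Ioi 0)

open Filter Topology

/-- Convolution on the half-line `(0, ∞)`. -/
noncomputable def halfLineConv (f g : ℝ → ℂ) (t : ℝ) : ℂ :=
  ∫ s in (0:ℝ)..t, f s * g (t - s)

/-- The `L¹` norm on the half-line `(0, ∞)`. -/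
noncomputable def halfLineNorm (f : ℝ → ℂ) : ℝ :=
  ∫ t in Ioi (0:ℝ), ‖f t‖

theorem halfLineNorm_nonneg (f : ℝ → ℂ) : 0 ≤ halfLineNorm f :=
  integral_nonneg fun _ => norm_nonneg _

theorem integrableOn_halfLineConv {f g : ℝ → ℂ} (hf : IntegrableOn f (Ioi 0))
    (hg : IntegrableOn g (Ioi 0)) : IntegrableOn (halfLineConv f g) (Ioi 0) := by
  have h := integrable_posConvolution hf hg (ContinuousLinearMap.mul ℝ ℂ)
  exact (integrable_indicator_iff measurableSet_Ioi).1 h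

theorem halfLineNorm_conv_le {f g : ℝ → ℂ} (hf : IntegrableOn f (Ioi 0))
    (hg : IntegrableOn g (Ioi 0)) :
    halfLineNorm (halfLineConv f g) ≤ halfLineNorm f * halfLineNorm g := by
  have h := integral_posConvolution hf.norm hg.norm (ContinuousLinearMap.mul ℝ ℝ)
  simp only [ContinuousLinearMap.mul_apply'] at h
  rw [halfLineNorm, halfLineNorm, halfLineNorm, ← h]
  refine setIntegral_mono_on (integrableOn_halfLineConv hf hg).norm ?_ measurableSet_Ioi ?_
  · have h' := integrable_posConvolution hf.norm hg.norm (ContinuousLinearMap.mul ℝ ℝ)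
    exact (integrable_indicator_iff measurableSet_Ioi).1 h'
  · intro t ht
    rw [halfLineConv]
    refine (intervalIntegral.norm_integral_le_integral_norm (le_of_lt ht)).trans_eq ?_
    simp only [norm_mul]

theorem ae_intervalIntegrable_halfLineConv {f g : ℝ → ℂ} (hf : IntegrableOn f (Ioi 0))
    (hg : IntegrableOn g (Ioi 0)) :
    ∀ᵐ t ∂(volume.restrict (Ioi (0:ℝ))),
      IntervalIntegrable (fun s => f s * g (t - s)) volume 0 t := by
  rw [IntegrableOn, ← IntegrableOn, ← integrable_indicator_iff measurableSet_Ioi] at hf hg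
  have h := hf.ae_convolution_exists (ContinuousLinearMap.mul ℝ ℂ) hg
  filter_upwards [ae_restrict_of_ae h, ae_restrict_mem measurableSet_Ioi] with t ht h0
  rw [intervalIntegrable_iff_integrableOn_Ioo_of_le (le_of_lt h0)]
  refine (ht.integrableOn (s := Ioo 0 t)).congr_fun ?_ measurableSet_Ioo
  intro s hs
  simp [indicator_of_mem (show s ∈ Ioi (0:ℝ) from hs.1),
    indicator_of_mem (show t - s ∈ Ioi (0:ℝ) from sub_pos.2 hs.2)]

theorem halfLineConv_sub_halfLineConv {f g f' g' : ℝ → ℂ} (hf : IntegrableOn f (Ioi 0))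
    (hg : IntegrableOn g (Ioi 0)) (hf' : IntegrableOn f' (Ioi 0))
    (hg' : IntegrableOn g' (Ioi 0)) :
    halfLineConv f g - halfLineConv f' g' =ᵐ[volume.restrict (Ioi (0:ℝ))]
      halfLineConv (f - f') g + halfLineConv f' (g - g') := by
  filter_upwards [ae_intervalIntegrable_halfLineConv hf hg,
    ae_intervalIntegrable_halfLineConv hf' hg,
    ae_intervalIntegrable_halfLineConv hf' hg'] with t h1 h2 h3
  simp only [Pi.sub_apply, Pi.add_apply, halfLineConv, sub_mul, mul_sub]
  rw [intervalIntegral.integral_sub h1 h2, intervalIntegral.integral_sub h2 h3]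
  ring

theorem halfLineNorm_conv_sub_conv_le {f g f' g' : ℝ → ℂ} (hf : IntegrableOn f (Ioi 0))
    (hg : IntegrableOn g (Ioi 0)) (hf' : IntegrableOn f' (Ioi 0))
    (hg' : IntegrableOn g' (Ioi 0)) :
    halfLineNorm (halfLineConv f g - halfLineConv f' g') ≤
      halfLineNorm (f - f') * halfLineNorm g + halfLineNorm f' * halfLineNorm (g - g') := by
  refine le_trans ?_ (add_le_add (halfLineNorm_conv_le (hf.sub hf') hg)
    (halfLineNorm_conv_le hf' (hg.sub hg')))
  have i1 := (integrableOn_halfLineConv (hf.sub hf') hg).norm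
  have i2 := (integrableOn_halfLineConv hf' (hg.sub hg')).norm
  rw [halfLineNorm, halfLineNorm, halfLineNorm, ← integral_add i1 i2]
  refine integral_mono_ae
    ((integrableOn_halfLineConv hf hg).sub (integrableOn_halfLineConv hf' hg')).norm (i1.add i2) ?_
  filter_upwards [halfLineConv_sub_halfLineConv hf hg hf' hg'] with t ht
  rw [ht]
  exact norm_add_le _ _

/-- The exponential weight `t ↦ e^{-νt}`. -/
noncomputable def expWeight (ν : ℝ) (t : ℝ) : ℂ := (Real.exp (-ν * t) : ℂ)

theorem integrableOn_expWeight {ν : ℝ} (hν : 0 < ν) : IntegrableOn (expWeight ν) (Ioi 0) :=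
  (integrableOn_exp_mul_Ioi (neg_lt_zero.2 hν) 0).ofReal

theorem norm_expWeight (ν t : ℝ) : ‖expWeight ν t‖ = Real.exp (-ν * t) := by
  rw [expWeight, Complex.norm_real, Real.norm_eq_abs, abs_of_pos (Real.exp_pos _)]

theorem expWeight_ne_zero (ν t : ℝ) : expWeight ν t ≠ 0 :=
  Complex.ofReal_ne_zero.2 (Real.exp_pos _).ne'

theorem expWeight_mul_expWeight_sub (ν s t : ℝ) :
    expWeight ν s * expWeight ν (t - s) = expWeight ν t := by
  rw [expWeight, expWeight, expWeight, ← Complex.ofReal_mul, ← Real.exp_add]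
  ring_nf

theorem continuous_expWeight (ν : ℝ) : Continuous (expWeight ν) := by
  unfold expWeight
  fun_prop

theorem halfLineNorm_expWeight {ν : ℝ} (hν : 0 < ν) : halfLineNorm (expWeight ν) = ν⁻¹ := by
  simp only [halfLineNorm, norm_expWeight]
  rw [integral_exp_mul_Ioi (neg_lt_zero.2 hν)]
  simp

theorem halfLineConv_expWeight_mul (ν : ℝ) (f g : ℝ → ℂ) :
    halfLineConv (fun t => f t * expWeight ν t) (fun t => g t * expWeight ν t) =
      fun t => halfLineConv f g t * expWeight ν t := by
  funext t
  rw [halfLineConv, halfLineConv, ← intervalIntegral.integral_mul_const]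
  refine intervalIntegral.integral_congr fun s _ => ?_
  rw [← expWeight_mul_expWeight_sub ν s t]
  ring

/-- The right-hand side of the Borel transformed equation, divided by `w` and with the
exponential weight `e^{-νt}` absorbed in the unknown. -/
noncomputable def borelRhs (β a b w : ℂ) (ν : ℝ) (f : ℝ → ℂ) (t : ℝ) : ℂ :=
  halfLineConv (expWeight ν) (expWeight ν) t - β * halfLineConv f (expWeight ν) t
    + a * halfLineConv f f t + b * w * halfLineConv (halfLineConv f f) f t

/-- The map whose fixed points are the solutions of the weighted equation. -/
noncomputable def borelMap (β a b w : ℂ) (ν : ℝ) (f : ℝ → ℂ) (t : ℝ) : ℂ :=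
  w / (1 - (t : ℂ) * w) * borelRhs β a b w ν f t

theorem integrableOn_borelRhs (β a b w : ℂ) {ν : ℝ} (hν : 0 < ν) {f : ℝ → ℂ}
    (hf : IntegrableOn f (Ioi 0)) : IntegrableOn (borelRhs β a b w ν f) (Ioi 0) := by
  have he := integrableOn_expWeight hν
  have hff := integrableOn_halfLineConv hf hf
  exact (((integrableOn_halfLineConv he he).sub
    ((integrableOn_halfLineConv hf he).const_mul β)).add (hff.const_mul a)).add
      ((integrableOn_halfLineConv hff hf).const_mul (b * w))

theorem halfLineNorm_borelRhs_sub_le (β a b : ℂ) {w : ℂ} (hw : ‖w‖ = 1) {ν : ℝ} (hν : 0 < ν)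
    {f g : ℝ → ℂ} (hf : IntegrableOn f (Ioi 0)) (hg : IntegrableOn g (Ioi 0)) :
    halfLineNorm (borelRhs β a b w ν f - borelRhs β a b w ν g) ≤
      (‖β‖ * ν⁻¹ + ‖a‖ * (halfLineNorm f + halfLineNorm g)
        + ‖b‖ * ((halfLineNorm f + halfLineNorm g) * halfLineNorm f + halfLineNorm g ^ 2))
        * halfLineNorm (f - g) := by
  have he := integrableOn_expWeight hν
  have hff := integrableOn_halfLineConv hf hf
  have hgg := integrableOn_halfLineConv hg hg
  have n1 := halfLineNorm_conv_sub_conv_le hf he hg he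
  have n2 := halfLineNorm_conv_sub_conv_le hf hf hg hg
  have n3 := halfLineNorm_conv_sub_conv_le hff hf hgg hg
  have n4 := halfLineNorm_conv_le hg hg
  have z : halfLineNorm (expWeight ν - expWeight ν) = 0 := by simp [halfLineNorm]
  rw [z, halfLineNorm_expWeight hν] at n1
  have i1 := ((integrableOn_halfLineConv hf he).sub (integrableOn_halfLineConv hg he)).norm
  have i2 := (hff.sub hgg).norm
  have i3 := ((integrableOn_halfLineConv hff hf).sub (integrableOn_halfLineConv hgg hg)).norm
  have key : halfLineNorm (borelRhs β a b w ν f - borelRhs β a b w ν g) ≤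
      ‖β‖ * halfLineNorm (halfLineConv f (expWeight ν) - halfLineConv g (expWeight ν))
      + ‖a‖ * halfLineNorm (halfLineConv f f - halfLineConv g g)
      + ‖b‖ * halfLineNorm (halfLineConv (halfLineConv f f) f
          - halfLineConv (halfLineConv g g) g) := by
    have e := integral_add ((i1.const_mul ‖β‖).add (i2.const_mul ‖a‖)) (i3.const_mul ‖b‖)
    have e' := integral_add (i1.const_mul ‖β‖) (i2.const_mul ‖a‖)
    simp only [Pi.add_apply] at e
    rw [e', integral_const_mul, integral_const_mul, integral_const_mul] at e
    simp only [halfLineNorm]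
    rw [← e]
    refine integral_mono ((integrableOn_borelRhs β a b w hν hf).sub
      (integrableOn_borelRhs β a b w hν hg)).norm
      (((i1.const_mul ‖β‖).add (i2.const_mul ‖a‖)).add (i3.const_mul ‖b‖)) fun t => ?_
    simp only [Pi.sub_apply, borelRhs]
    have : ∀ p x y z x' y' z' : ℂ, ‖(p - β * x + a * y + b * w * z)
        - (p - β * x' + a * y' + b * w * z')‖
        ≤ ‖β‖ * ‖x - x'‖ + ‖a‖ * ‖y - y'‖ + ‖b‖ * ‖z - z'‖ := by
      intro p x y z x' y' z'
      have h : (p - β * x + a * y + b * w * z) - (p - β * x' + a * y' + b * w * z')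
        = -(β * (x - x')) + a * (y - y') + b * w * (z - z') := by ring
      rw [h]
      refine (norm_add₃_le).trans_eq ?_
      simp [hw]
    exact this _ _ _ _ _ _ _
  have d0 := halfLineNorm_nonneg (f - g)
  have f0 := halfLineNorm_nonneg f
  refine key.trans ?_
  calc _ ≤ ‖β‖ * (halfLineNorm (f - g) * ν⁻¹ + halfLineNorm g * 0)
        + ‖a‖ * (halfLineNorm (f - g) * halfLineNorm f + halfLineNorm g * halfLineNorm (f - g))
        + ‖b‖ * ((halfLineNorm (f - g) * halfLineNorm f + halfLineNorm g * halfLineNorm (f - g))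
          * halfLineNorm f + (halfLineNorm g * halfLineNorm g) * halfLineNorm (f - g)) := by
        gcongr
        refine n3.trans ?_
        gcongr
    _ = _ := by ring

theorem measurable_rayFactor (w : ℂ) : Measurable fun t : ℝ => w / (1 - (t : ℂ) * w) := by
  have : Measurable fun t : ℝ => 1 - (t : ℂ) * w := by fun_prop
  exact measurable_const.div this

section Bounded

variable {w : ℂ} {C : ℝ} (hC : ∀ t : ℝ, 0 < t → ‖w / (1 - (t : ℂ) * w)‖ ≤ C)
include hC

theorem integrableOn_borelMap (β a b : ℂ) {ν : ℝ} (hν : 0 < ν)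
    {f : ℝ → ℂ} (hf : IntegrableOn f (Ioi 0)) :
    IntegrableOn (borelMap β a b w ν f) (Ioi 0) :=
  (integrableOn_borelRhs β a b w hν hf).bdd_mul (measurable_rayFactor w).aestronglyMeasurable
    (ae_restrict_of_forall_mem measurableSet_Ioi hC)

theorem halfLineNorm_mul_le {f : ℝ → ℂ} (hf : IntegrableOn f (Ioi 0)) :
    halfLineNorm (fun t => w / (1 - (t : ℂ) * w) * f t) ≤ C * halfLineNorm f := by
  rw [halfLineNorm, halfLineNorm, ← integral_const_mul]
  refine setIntegral_mono_on (Integrable.bdd_mul hf (measurable_rayFactor w).aestronglyMeasurable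
    (ae_restrict_of_forall_mem measurableSet_Ioi hC)).norm
    (hf.norm.const_mul C) measurableSet_Ioi fun t ht => ?_
  simp only [norm_mul]
  gcongr
  exact hC t ht

theorem halfLineNorm_borelMap_sub_le (β a b : ℂ) (hw : ‖w‖ = 1) {ν : ℝ} (hν : 0 < ν)
    {f g : ℝ → ℂ} (hf : IntegrableOn f (Ioi 0)) (hg : IntegrableOn g (Ioi 0)) :
    halfLineNorm (borelMap β a b w ν f - borelMap β a b w ν g) ≤
      C * (‖β‖ * ν⁻¹ + ‖a‖ * (halfLineNorm f + halfLineNorm g)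
        + ‖b‖ * ((halfLineNorm f + halfLineNorm g) * halfLineNorm f + halfLineNorm g ^ 2))
        * halfLineNorm (f - g) := by
  have h := halfLineNorm_mul_le hC ((integrableOn_borelRhs β a b w hν hf).sub
    (integrableOn_borelRhs β a b w hν hg))
  have hC0 : 0 ≤ C := (norm_nonneg _).trans (hC 1 one_pos)
  have e : borelMap β a b w ν f - borelMap β a b w ν g = fun t : ℝ => w / (1 - (t : ℂ) * w) *
      (borelRhs β a b w ν f - borelRhs β a b w ν g) t := by
    funext t
    simp only [borelMap, Pi.sub_apply, mul_sub]
  rw [e, mul_assoc]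
  exact h.trans (mul_le_mul_of_nonneg_left (halfLineNorm_borelRhs_sub_le β a b hw hν hf hg) hC0)

theorem halfLineNorm_borelMap_zero_le (β a b : ℂ) {ν : ℝ} (hν : 0 < ν) :
    halfLineNorm (borelMap β a b w ν 0) ≤ C * (ν⁻¹ * ν⁻¹) := by
  have he := integrableOn_expWeight hν
  have hC0 : 0 ≤ C := (norm_nonneg _).trans (hC 1 one_pos)
  have e : borelMap β a b w ν 0 = fun t : ℝ => w / (1 - (t : ℂ) * w) *
      halfLineConv (expWeight ν) (expWeight ν) t := by
    funext t
    simp [borelMap, borelRhs, halfLineConv]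
  rw [e]
  refine (halfLineNorm_mul_le hC (integrableOn_halfLineConv he he)).trans ?_
  refine mul_le_mul_of_nonneg_left ?_ hC0
  simpa only [halfLineNorm_expWeight hν] using halfLineNorm_conv_le he he

end Bounded

theorem ae_eq_of_halfLineNorm_sub_le_zero {f g : ℝ → ℂ} (hf : IntegrableOn f (Ioi 0))
    (hg : IntegrableOn g (Ioi 0)) (h : halfLineNorm (f - g) ≤ 0) :
    f =ᵐ[volume.restrict (Ioi (0:ℝ))] g := by
  have h0 := le_antisymm h (halfLineNorm_nonneg _)
  rw [halfLineNorm, integral_eq_zero_iff_of_nonneg (fun _ => norm_nonneg _)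
    (hf.sub hg).norm] at h0
  filter_upwards [h0] with t ht
  simpa [sub_eq_zero] using ht

theorem halfLineNorm_congr {f g : ℝ → ℂ} (h : f =ᵐ[volume.restrict (Ioi (0:ℝ))] g) :
    halfLineNorm f = halfLineNorm g :=
  integral_congr_ae (h.mono fun _ ht => congrArg norm ht)

theorem borelRayEq_iff_borelMap {β a b w : ℂ} (hw : ∀ t : ℝ, 0 < t → 1 - (t : ℂ) * w ≠ 0) (ν : ℝ)
    (F : ℝ → ℂ) :
    BorelRayEq β a b w F ↔
      (fun t => F t * expWeight ν t) =ᵐ[volume.restrict (Ioi (0:ℝ))]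
        borelMap β a b w ν (fun t => F t * expWeight ν t) := by
  have h1 : halfLineConv (expWeight ν) (expWeight ν) = fun t : ℝ => (t : ℂ) * expWeight ν t := by
    have h := halfLineConv_expWeight_mul ν (fun _ => 1) (fun _ => 1)
    simp only [one_mul] at h
    refine h.trans (funext fun t => ?_)
    simp [halfLineConv]
  have h2 : halfLineConv (fun t => F t * expWeight ν t) (expWeight ν) =
      fun t => (∫ s in (0:ℝ)..t, F s) * expWeight ν t := by
    have h := halfLineConv_expWeight_mul ν F (fun _ => 1)
    simpa only [one_mul, halfLineConv, mul_one] using h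
  refine eventually_congr ((ae_restrict_mem measurableSet_Ioi).mono fun t ht => ?_)
  rw [borelMap, borelRhs, h1, h2, halfLineConv_expWeight_mul, halfLineConv_expWeight_mul]
  have hE := expWeight_ne_zero ν t
  have hd := hw t ht
  simp only [halfLineConv]
  rw [div_mul_eq_mul_div, eq_div_iff hd, ← mul_left_inj' hE]
  ring_nf

theorem memLoneNu_iff {ν : ℝ} {F : ℝ → ℂ} :
    MemLoneNu ν F ↔ Measurable F ∧ IntegrableOn (fun t => F t * expWeight ν t) (Ioi 0) := by
  refine and_congr_right fun hF => ?_
  have hm : Measurable fun t => F t * expWeight ν t :=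
    hF.mul (continuous_expWeight ν).measurable
  rw [IntegrableOn, IntegrableOn, ← integrable_norm_iff hm.aestronglyMeasurable]
  simp only [norm_mul, norm_expWeight]

theorem MemLoneNu.mono {ν ν' : ℝ} (h : ν ≤ ν') {F : ℝ → ℂ} (hF : MemLoneNu ν F) :
    MemLoneNu ν' F := by
  refine ⟨hF.1, hF.2.mono' (hF.1.norm.mul (by fun_prop)).aestronglyMeasurable ?_⟩
  filter_upwards [ae_restrict_mem measurableSet_Ioi] with t ht
  rw [Real.norm_of_nonneg (by positivity)]
  gcongr
  exact le_of_lt ht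

theorem MemLoneNu.tendsto_halfLineNorm {ν : ℝ} {F : ℝ → ℂ} (hF : MemLoneNu ν F) :
    Tendsto (fun μ => halfLineNorm fun t => F t * expWeight μ t) atTop (𝓝 0) := by
  have h : Tendsto (fun μ => halfLineNorm fun t => F t * expWeight μ t) atTop
      (𝓝 (∫ _ in Ioi (0:ℝ), (0:ℝ))) := by
    refine tendsto_integral_filter_of_dominated_convergence
      (fun t => ‖F t‖ * Real.exp (-ν * t)) ?_ ?_ hF.2 ?_
    · exact Eventually.of_forall fun μ =>
        (hF.1.mul (continuous_expWeight μ).measurable).norm.aestronglyMeasurable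
    · filter_upwards [eventually_ge_atTop ν] with μ hμ
      filter_upwards [ae_restrict_mem measurableSet_Ioi] with t ht
      rw [norm_norm, norm_mul, norm_expWeight]
      gcongr
      exact le_of_lt ht
    · filter_upwards [ae_restrict_mem measurableSet_Ioi] with t ht
      simp only [norm_mul, norm_expWeight, neg_mul]
      have h1 : Tendsto (fun μ : ℝ => Real.exp (-(μ * t))) atTop (𝓝 0) :=
        Real.tendsto_exp_neg_atTop_nhds_zero.comp (tendsto_id.atTop_mul_const ht)
      simpa using h1.const_mul ‖F t‖
  simpa using h

theorem abs_im_le_norm_one_sub_mul {w : ℂ} (hw : ‖w‖ = 1) (t : ℝ) :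
    |w.im| ≤ ‖1 - (t : ℂ) * w‖ := by
  have h : (starRingEnd ℂ w) * (1 - (t : ℂ) * w) = starRingEnd ℂ w - t := by
    have h1 : starRingEnd ℂ w * w = 1 := by rw [Complex.conj_mul', hw]; simp
    linear_combination (-(t : ℂ)) * h1
  have h2 : ‖1 - (t : ℂ) * w‖ = ‖starRingEnd ℂ w - t‖ := by
    rw [← h, norm_mul, Complex.norm_conj, hw, one_mul]
  rw [h2]
  simpa using Complex.abs_im_le_norm (starRingEnd ℂ w - t)

theorem exists_le_norm_one_sub_mul {w : ℂ} (hw : ‖w‖ = 1) (hw1 : w ≠ 1) :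
    ∃ c : ℝ, 0 < c ∧ ∀ t : ℝ, 0 < t → c ≤ ‖1 - (t : ℂ) * w‖ := by
  by_cases him : w.im = 0
  · refine ⟨1, one_pos, fun t ht => ?_⟩
    have hre : w = (w.re : ℂ) := Complex.ext rfl (by simpa using him)
    have habs : |w.re| = 1 := by
      rw [hre, Complex.norm_real] at hw
      simpa using hw
    have hneg : w = -1 := by
      rcases eq_or_eq_neg_of_abs_eq habs with h | h
      · exact absurd (by rw [hre, h]; simp) hw1
      · rw [hre, h]; simp
    have h : (1 : ℂ) - t * w = ((1 + t : ℝ) : ℂ) := by rw [hneg]; push_cast; ring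
    rw [h, Complex.norm_real, Real.norm_of_nonneg (by positivity)]
    linarith
  · exact ⟨|w.im|, abs_pos.2 him, fun t _ => abs_im_le_norm_one_sub_mul hw t⟩

theorem exp_mul_I_ne_one {θ : ℝ} (hθ : θ ∈ Ioo 0 (2 * π)) : Complex.exp (θ * Complex.I) ≠ 1 := by
  intro h
  obtain ⟨n, hn⟩ := Complex.exp_eq_one_iff.1 h
  have h1 : θ = n * (2 * π) := by
    have := congrArg Complex.im hn
    simpa using this
  have hpi := Real.pi_pos
  rw [h1] at hθ
  have n0 : (0:ℝ) < n := by
    have := hθ.1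
    exact pos_of_mul_pos_left this (by positivity)
  have n1 : (n:ℝ) < 1 := by
    have := hθ.2
    nlinarith
  norm_cast at n0 n1
  omega

/-- Existence of a fixed point in the `L¹` ball of radius `R`, for a weight `ν` making the map a
contraction of that ball. -/
theorem exists_borelMap_fixedPoint {w : ℂ} {C : ℝ}
    (hC : ∀ t : ℝ, 0 < t → ‖w / (1 - (t : ℂ) * w)‖ ≤ C) (β a b : ℂ) (hw : ‖w‖ = 1) {ν R : ℝ}
    (hν : 0 < ν) (hR : 0 ≤ R)
    (hK : C * (‖β‖ * ν⁻¹ + ‖a‖ * (R + R) + ‖b‖ * ((R + R) * R + R ^ 2)) ≤ 1 / 2)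
    (h0 : C * (ν⁻¹ * ν⁻¹) ≤ R / 2) :
    ∃ g : ℝ → ℂ, Measurable g ∧ IntegrableOn g (Ioi 0) ∧
      g =ᵐ[volume.restrict (Ioi (0:ℝ))] borelMap β a b w ν g := by
  have hC0 : 0 ≤ C := (norm_nonneg _).trans (hC 1 one_pos)
  let μ : Measure ℝ := volume.restrict (Ioi (0:ℝ))
  have hi : ∀ f : Lp ℂ 1 μ, IntegrableOn f (Ioi 0) := fun f => L1.integrable_coeFn f
  have hT := fun f : Lp ℂ 1 μ => integrableOn_borelMap hC β a b hν (hi f)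
  let T : Lp ℂ 1 μ → Lp ℂ 1 μ := fun f => (hT f).toL1 _
  have hTae : ∀ f, T f =ᵐ[μ] borelMap β a b w ν f := fun f => (hT f).coeFn_toL1
  have hnorm : ∀ f : Lp ℂ 1 μ, ‖f‖ = halfLineNorm f := fun f => L1.norm_eq_integral_norm f
  have hdist : ∀ f g : Lp ℂ 1 μ, dist f g = halfLineNorm (f - g : ℝ → ℂ) := fun f g => by
    rw [dist_eq_norm, hnorm]
    exact halfLineNorm_congr (Lp.coeFn_sub f g)
  have hle : ∀ (f g : ℝ → ℂ), IntegrableOn f (Ioi 0) → IntegrableOn g (Ioi 0) →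
      halfLineNorm f ≤ R → halfLineNorm g ≤ R →
      halfLineNorm (borelMap β a b w ν f - borelMap β a b w ν g) ≤
        1 / 2 * halfLineNorm (f - g) := by
    intro f g hf hg hfR hgR
    refine (halfLineNorm_borelMap_sub_le hC β a b hw hν hf hg).trans ?_
    have f0 := halfLineNorm_nonneg f
    have g0 := halfLineNorm_nonneg g
    refine mul_le_mul_of_nonneg_right (le_trans ?_ hK) (halfLineNorm_nonneg _)
    gcongr
  have hball : ∀ f : Lp ℂ 1 μ, f ∈ Metric.closedBall (0 : Lp ℂ 1 μ) R ↔ halfLineNorm f ≤ R := by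
    intro f
    rw [mem_closedBall_zero_iff, hnorm]
  have hmaps : MapsTo T (Metric.closedBall 0 R) (Metric.closedBall 0 R) := by
    intro f hf
    rw [hball] at hf ⊢
    have z : halfLineNorm 0 = 0 := by simp [halfLineNorm]
    have i0 : IntegrableOn (0 : ℝ → ℂ) (Ioi 0) := integrable_zero _ _ _
    have h1 := hle f 0 (hi f) i0 hf (by rw [z]; exact hR)
    have h2 := (halfLineNorm_borelMap_zero_le hC β a b hν).trans h0
    rw [sub_zero] at h1
    rw [halfLineNorm_congr (hTae f)]
    have h3 : halfLineNorm (borelMap β a b w ν f) ≤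
        halfLineNorm (borelMap β a b w ν f - borelMap β a b w ν 0)
          + halfLineNorm (borelMap β a b w ν 0) := by
      have j0 := integrableOn_borelMap hC β a b hν i0
      rw [halfLineNorm, halfLineNorm, halfLineNorm, ← integral_add ((hT f).sub j0).norm j0.norm]
      refine integral_mono (hT f).norm (((hT f).sub j0).norm.add j0.norm) fun t => ?_
      exact norm_le_norm_sub_add _ _
    linarith
  have hcontr : ContractingWith (1 / 2) (hmaps.restrict T _ _) := by
    refine ⟨by rw [← NNReal.coe_lt_coe]; norm_num, LipschitzWith.of_dist_le_mul fun f g => ?_⟩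
    have hf := (hball f).1 f.2
    have hg := (hball g).1 g.2
    have h := hle f g (hi f) (hi g) hf hg
    rw [Subtype.dist_eq, Subtype.dist_eq, MapsTo.val_restrict_apply, MapsTo.val_restrict_apply,
      hdist, hdist, halfLineNorm_congr ((hTae f).sub (hTae g))]
    simpa using h
  obtain ⟨g, -, hg, -⟩ := hcontr.exists_fixedPoint' Metric.isClosed_closedBall.isComplete hmaps
    (Metric.mem_closedBall_self hR) (edist_ne_top _ _)
  refine ⟨g, (Lp.stronglyMeasurable g).measurable, hi g, ?_⟩
  have h := hTae g
  rwa [show T g = g from hg] at h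

/-- Two solutions of the Borel transformed equation with finite weighted norms agree almost
everywhere: their norms tend to zero as the weight grows, which makes the map contracting. -/
theorem BorelRayEq.ae_eq {w : ℂ} {C : ℝ}
    (hC : ∀ t : ℝ, 0 < t → ‖w / (1 - (t : ℂ) * w)‖ ≤ C) (hw : ‖w‖ = 1)
    (hd : ∀ t : ℝ, 0 < t → 1 - (t : ℂ) * w ≠ 0) {β a b : ℂ} {ν₁ ν₂ : ℝ} {F₁ F₂ : ℝ → ℂ}
    (h₁ : BorelRayEq β a b w F₁) (h₂ : BorelRayEq β a b w F₂)
    (hF₁ : MemLoneNu ν₁ F₁) (hF₂ : MemLoneNu ν₂ F₂) :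
    F₁ =ᵐ[volume.restrict (Ioi (0:ℝ))] F₂ := by
  have l1 := hF₁.tendsto_halfLineNorm
  have l2 := hF₂.tendsto_halfLineNorm
  have l : Tendsto (fun μ : ℝ => C * (‖β‖ * μ⁻¹
      + ‖a‖ * (halfLineNorm (fun t => F₁ t * expWeight μ t)
        + halfLineNorm (fun t => F₂ t * expWeight μ t))
      + ‖b‖ * ((halfLineNorm (fun t => F₁ t * expWeight μ t)
        + halfLineNorm (fun t => F₂ t * expWeight μ t))
          * halfLineNorm (fun t => F₁ t * expWeight μ t)
        + halfLineNorm (fun t => F₂ t * expWeight μ t) ^ 2))) atTop (𝓝 0) := by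
    have h := ((((tendsto_inv_atTop_zero (𝕜 := ℝ)).const_mul ‖β‖).add
      ((l1.add l2).const_mul ‖a‖)).add
        ((((l1.add l2).mul l1).add (l2.pow 2)).const_mul ‖b‖)).const_mul C
    simpa using h
  obtain ⟨ν, hlt, hν, hν₁, hν₂⟩ := ((l.eventually_lt_const one_pos).and
    ((eventually_gt_atTop 0).and
      ((eventually_ge_atTop ν₁).and (eventually_ge_atTop ν₂)))).exists
  have i1 := (memLoneNu_iff.1 (hF₁.mono hν₁)).2
  have i2 := (memLoneNu_iff.1 (hF₂.mono hν₂)).2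
  have e1 := (borelRayEq_iff_borelMap hd ν F₁).1 h₁
  have e2 := (borelRayEq_iff_borelMap hd ν F₂).1 h₂
  have hle := halfLineNorm_borelMap_sub_le hC β a b hw hν i1 i2
  rw [← halfLineNorm_congr (e1.sub e2)] at hle
  have h0 := ae_eq_of_halfLineNorm_sub_le_zero i1 i2 (by
    have := halfLineNorm_nonneg
      ((fun t => F₁ t * expWeight ν t) - fun t => F₂ t * expWeight ν t)
    nlinarith)
  filter_upwards [h0] with t ht
  exact mul_right_cancel₀ (expWeight_ne_zero ν t) ht

/-- Along any ray `arg p = θ ∈ (0, 2π)` avoiding the singular point `p = 1`, the Borel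
transformed equation has a solution in `L¹_ν` for every large enough `ν`, and this
solution is unique (a.e.) in the union `⋃_{ν ≥ ν₀} L¹_ν`. -/
theorem stmt_14 (β a b : ℂ) (θ : ℝ) (hθ : θ ∈ Ioo 0 (2 * π))
    (w : ℂ) (hw : w = Complex.exp (θ * Complex.I)) :
    ∃ ν₀ : ℝ, 0 < ν₀ ∧
      (∀ ν : ℝ, ν₀ ≤ ν → ∃ F : ℝ → ℂ, MemLoneNu ν F ∧ BorelRayEq β a b w F) ∧
      (∀ F₁ F₂ : ℝ → ℂ,
        (∃ ν₁ : ℝ, ν₀ ≤ ν₁ ∧ MemLoneNu ν₁ F₁) → BorelRayEq β a b w F₁ →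
        (∃ ν₂ : ℝ, ν₀ ≤ ν₂ ∧ MemLoneNu ν₂ F₂) → BorelRayEq β a b w F₂ →
        F₁ =ᵐ[volume.restrict (Ioi (0:ℝ))] F₂) := by
  have hw1 : ‖w‖ = 1 := by rw [hw, Complex.norm_exp_ofReal_mul_I]
  obtain ⟨c, hc, hcw⟩ := exists_le_norm_one_sub_mul hw1 (hw ▸ exp_mul_I_ne_one hθ)
  have hd : ∀ t : ℝ, 0 < t → 1 - (t : ℂ) * w ≠ 0 := fun t ht =>
    norm_pos_iff.1 (hc.trans_le (hcw t ht))
  have hC : ∀ t : ℝ, 0 < t → ‖w / (1 - (t : ℂ) * w)‖ ≤ c⁻¹ := fun t ht => by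
    rw [norm_div, hw1, one_div]
    exact inv_anti₀ hc (hcw t ht)
  have lR : Tendsto (fun R : ℝ => c⁻¹ * (‖a‖ * (R + R) + ‖b‖ * ((R + R) * R + R ^ 2)))
      (𝓝[>] 0) (𝓝 0) := by
    refine tendsto_nhdsWithin_of_tendsto_nhds ?_
    refine (Continuous.tendsto (by fun_prop) 0).trans_eq ?_
    simp
  obtain ⟨R, hR4, hR⟩ := ((lR.eventually_lt_const (show (0:ℝ) < 1 / 4 by norm_num)).and
    self_mem_nhdsWithin).exists
  have hR : 0 < R := hR
  have linv := tendsto_inv_atTop_zero (𝕜 := ℝ)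
  have lβ : Tendsto (fun ν : ℝ => c⁻¹ * (‖β‖ * ν⁻¹)) atTop (𝓝 0) := by
    simpa using (linv.const_mul ‖β‖).const_mul c⁻¹
  have l0 : Tendsto (fun ν : ℝ => c⁻¹ * (ν⁻¹ * ν⁻¹)) atTop (𝓝 0) := by
    simpa using (linv.mul linv).const_mul c⁻¹
  obtain ⟨N, hN⟩ := eventually_atTop.1 ((lβ.eventually_lt_const
    (show (0:ℝ) < 1 / 4 by norm_num)).and (l0.eventually_lt_const (half_pos hR)))
  refine ⟨max N 1, by positivity, fun ν hν => ?_, ?_⟩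
  · obtain ⟨hβ, h0⟩ := hN ν ((le_max_left _ _).trans hν)
    have hν0 : 0 < ν := one_pos.trans_le ((le_max_right _ _).trans hν)
    obtain ⟨g, hgm, hgi, hg⟩ := exists_borelMap_fixedPoint hC β a b hw1 hν0 hR.le
      (by linarith) h0.le
    have e : (fun t => g t / expWeight ν t * expWeight ν t) = g :=
      funext fun t => div_mul_cancel₀ _ (expWeight_ne_zero ν t)
    refine ⟨fun t => g t / expWeight ν t, memLoneNu_iff.2
      ⟨hgm.div (continuous_expWeight ν).measurable, ?_⟩, (borelRayEq_iff_borelMap hd ν _).2 ?_⟩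
    · rwa [e]
    · rwa [e]
  · rintro F₁ F₂ ⟨ν₁, -, hF₁⟩ h₁ ⟨ν₂, -, hF₂⟩ h₂
    exact h₁.ae_eq hC hw1 hd h₂ hF₁ hF₂
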